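/- Let p ≥ 4 and c ≥ 2, and let C = {1, 2c}. Then for every n ≥ p, N(n+1, p+1, C) = N(n, p, C). -/

import Mathlib

/-- The minimum excludant of a set of naturals. -/
noncomputable def mex (S : Set ℕ) : ℕ := sInf {v | v ∉ S}

/-- Fueled auxiliary for the Grundy sequence of CUT with cut-set `C`. -/
noncomputable def cutGAux (C : Finset ℕ) : ℕ → ℕ → ℕ
  | 0, _ => 0
  | fuel + 1, n =>
      mex {v | ∃ d ∈ C, ∃ l : List ℕ, l.length = d + 1 ∧ (∀ x ∈ l, 0 < x) ∧
            l.sum = n ∧ (l.map (cutGAux C fuel)).foldr (· ^^^ ·) 0 = v}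

/-- The Grundy (nim-value) sequence of the game CUT with cut-set `C`. -/
noncomputable def cutG (C : Finset ℕ) (n : ℕ) : ℕ := cutGAux C n n

/-- The nim-value of an option (a tuple of pile sizes). -/
noncomputable def nimVal (C : Finset ℕ) (l : List ℕ) : ℕ :=
  (l.map (cutG C)).foldr (· ^^^ ·) 0

/-- The nim-set `N(n, p, C)`. -/
def nimSet (n p : ℕ) (C : Finset ℕ) : Set ℕ :=
  {v | ∃ l : List ℕ, l.length = p ∧ (∀ x ∈ l, 0 < x) ∧ l.sum = n ∧ nimVal C l = v}

/-- One period (of length `12 * c`) of the Grundy sequence for the cut-set `{1, 2 * c}`,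
indexed from zero. -/
def cutPeriod (c x : ℕ) : ℕ :=
  if x < 2 * c then x % 2
  else if x < 4 * c then 2 + x % 2
  else if x = 4 * c then 1
  else if x < 6 * c then 5 - x % 2
  else if x < 8 * c then 3 - x % 2
  else if x < 10 * c then 4 + x % 2
  else 6 + x % 2

/-- The closed form of the Grundy sequence for the cut-set `{1, 2 * c}`, indexed from zero. -/
def cutClosed (c k : ℕ) : ℕ := 8 * (k / (12 * c)) + cutPeriod c (k % (12 * c))

/-- The least number of parity `e` which is a sum of indices whose `cutClosed` values have
nim-sum `r`, for `r < 8`. -/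
def cutThreshold (c : ℕ) : ℕ → ℕ → ℕ
  | 0, 0 => 0
  | 0, _ => 4 * c + 1
  | 1, 0 => 4 * c
  | 1, _ => 1
  | 2, 0 => 2 * c
  | 2, _ => 6 * c + 1
  | 3, 0 => 6 * c
  | 3, _ => 2 * c + 1
  | 4, 0 => 8 * c
  | 4, _ => 4 * c + 1
  | 5, 0 => 4 * c + 2
  | 5, _ => 8 * c + 1
  | 6, 0 => 10 * c
  | 6, _ => 6 * c + 1
  | _, 0 => 6 * c + 2
  | _, _ => 10 * c + 1

/-- The value `v` is a nim-sum of `cutClosed` values whose indices sum to `m`, as expressed by the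
thresholds. -/
def CutReach (c m v : ℕ) : Prop :=
  12 * c * (v / 8) + cutThreshold c (v % 8) (m % 2) ≤ m

theorem xor_le_add (a b : ℕ) : a ^^^ b ≤ a + b := by
  induction a using Nat.strong_induction_on generalizing b with
  | _ a ih =>
    rcases Nat.eq_zero_or_pos a with rfl | ha
    · simp
    · have h := ih (a / 2) (by omega) (b / 2)
      have hd : (a ^^^ b) / 2 = a / 2 ^^^ b / 2 := by
        simpa using Nat.xor_div_two_pow (a := a) (b := b) (n := 1)
      have hm : (a ^^^ b) % 2 = (a + b) % 2 := Nat.xor_mod_two_eq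
      omega

theorem xor_div_eight (a b : ℕ) : (a ^^^ b) / 8 = a / 8 ^^^ b / 8 :=
  Nat.xor_div_two_pow (n := 3)

theorem xor_mod_eight (a b : ℕ) : (a ^^^ b) % 8 = a % 8 ^^^ b % 8 :=
  Nat.xor_mod_two_pow (n := 3)

theorem cutPeriod_spec (c x : ℕ) (hx : x < 12 * c) :
    (cutPeriod c x = 0 ∧ x < 2 * c ∧ x % 2 = 0) ∨
    (cutPeriod c x = 1 ∧ x < 2 * c ∧ x % 2 = 1) ∨
    (cutPeriod c x = 2 ∧ 2 * c ≤ x ∧ x < 4 * c ∧ x % 2 = 0) ∨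
    (cutPeriod c x = 3 ∧ 2 * c ≤ x ∧ x < 4 * c ∧ x % 2 = 1) ∨
    (cutPeriod c x = 1 ∧ x = 4 * c) ∨
    (cutPeriod c x = 5 ∧ 4 * c < x ∧ x < 6 * c ∧ x % 2 = 0) ∨
    (cutPeriod c x = 4 ∧ 4 * c < x ∧ x < 6 * c ∧ x % 2 = 1) ∨
    (cutPeriod c x = 3 ∧ 6 * c ≤ x ∧ x < 8 * c ∧ x % 2 = 0) ∨
    (cutPeriod c x = 2 ∧ 6 * c ≤ x ∧ x < 8 * c ∧ x % 2 = 1) ∨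
    (cutPeriod c x = 4 ∧ 8 * c ≤ x ∧ x < 10 * c ∧ x % 2 = 0) ∨
    (cutPeriod c x = 5 ∧ 8 * c ≤ x ∧ x < 10 * c ∧ x % 2 = 1) ∨
    (cutPeriod c x = 6 ∧ 10 * c ≤ x ∧ x < 12 * c ∧ x % 2 = 0) ∨
    (cutPeriod c x = 7 ∧ 10 * c ≤ x ∧ x < 12 * c ∧ x % 2 = 1) := by
  unfold cutPeriod
  rcases Nat.mod_two_eq_zero_or_one x with e | e <;> split_ifs <;>
  repeat first | (left; omega) | right
  all_goals omega

theorem cutPeriod_zero (c : ℕ) (hc : 0 < c) : cutPeriod c 0 = 0 :=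
  if_pos (by omega)

theorem cutPeriod_lt_eight (c x : ℕ) : cutPeriod c x < 8 := by
  unfold cutPeriod
  split_ifs <;> omega

theorem cutClosed_add_mul (c q x : ℕ) (hx : x < 12 * c) :
    cutClosed c (12 * c * q + x) = 8 * q + cutPeriod c x := by
  have h0 : 0 < 12 * c := by omega
  simp [cutClosed, Nat.mul_add_div h0, Nat.div_eq_of_lt hx, Nat.mod_eq_of_lt hx]

theorem cutClosed_of_lt (c x : ℕ) (hx : x < 12 * c) : cutClosed c x = cutPeriod c x := by
  simpa using cutClosed_add_mul c 0 x hx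

theorem cutPeriod_xor_ne (c x y : ℕ) (h : x + y + 1 < 12 * c) :
    cutPeriod c x ^^^ cutPeriod c y ≠ cutPeriod c (x + y + 1) := by
  have hz := cutPeriod_spec c (x + y + 1) h
  generalize cutPeriod c (x + y + 1) = z at hz
  rintro rfl
  rcases cutPeriod_spec c x (by omega) with hx | hx | hx | hx | hx | hx | hx | hx | hx | hx | hx |
    hx | hx <;>
  rcases cutPeriod_spec c y (by omega) with hy | hy | hy | hy | hy | hy | hy | hy | hy | hy | hy |
    hy | hy <;>
  simp only [hx.1, hy.1, Nat.reduceXor] at hz <;> omega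

theorem cutClosed_xor_ne (c k l : ℕ) (hc : 0 < c) :
    cutClosed c k ^^^ cutClosed c l ≠ cutClosed c (k + l + 1) := by
  have h0 : 0 < 12 * c := by omega
  obtain ⟨q, x, hx, rfl⟩ : ∃ q x, x < 12 * c ∧ k = 12 * c * q + x :=
    ⟨_, _, Nat.mod_lt k h0, (Nat.div_add_mod _ _).symm⟩
  obtain ⟨r, y, hy, rfl⟩ : ∃ q x, x < 12 * c ∧ l = 12 * c * q + x :=
    ⟨_, _, Nat.mod_lt l h0, (Nat.div_add_mod _ _).symm⟩
  have h8x := cutPeriod_lt_eight c x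
  have h8y := cutPeriod_lt_eight c y
  have hle := xor_le_add q r
  intro h
  have hd := congrArg (· / 8) h
  have hm := congrArg (· % 8) h
  simp only [xor_div_eight, xor_mod_eight, cutClosed_add_mul c q x hx,
    cutClosed_add_mul c r y hy] at hd hm
  rw [show (8 * q + cutPeriod c x) / 8 = q by omega,
    show (8 * r + cutPeriod c y) / 8 = r by omega] at hd
  rw [show (8 * q + cutPeriod c x) % 8 = cutPeriod c x by omega,
    show (8 * r + cutPeriod c y) % 8 = cutPeriod c y by omega] at hm
  by_cases hlt : x + y + 1 < 12 * c
  · rw [show 12 * c * q + x + (12 * c * r + y) + 1 = 12 * c * (q + r) + (x + y + 1) by ring,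
      cutClosed_add_mul c _ _ hlt] at hm
    have h8 := cutPeriod_lt_eight c (x + y + 1)
    exact cutPeriod_xor_ne c x y hlt (by omega)
  · have e : 12 * c * q + x + (12 * c * r + y) + 1
        = 12 * c * (q + r + 1) + (x + y + 1 - 12 * c) := by
      have : 12 * c * (q + r + 1) = 12 * c * q + 12 * c * r + 12 * c := by ring
      omega
    rw [e, cutClosed_add_mul c _ _ (by omega)] at hd
    omega

theorem cutThreshold_xor_le (c r s a b : ℕ) (hc : 0 < c) (hr : r < 8) (hs : s < 8) :
    cutThreshold c (r ^^^ s) ((a + b) % 2) ≤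
      cutThreshold c r (a % 2) + cutThreshold c s (b % 2) := by
  rw [Nat.add_mod]
  rcases Nat.mod_two_eq_zero_or_one a with ha | ha <;>
  rcases Nat.mod_two_eq_zero_or_one b with hb | hb <;>
  rw [ha, hb] <;> interval_cases r <;> interval_cases s <;>
  simp only [cutThreshold, Nat.reduceXor, Nat.reduceAdd, Nat.reduceMod] <;> omega

namespace CutReach

theorem xor {c m n v w : ℕ} (hc : 0 < c) (hv : CutReach c m v) (hw : CutReach c n w) :
    CutReach c (m + n) (v ^^^ w) := by
  unfold CutReach at *
  rw [xor_div_eight, xor_mod_eight]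
  have h := cutThreshold_xor_le c (v % 8) (w % 8) m n hc
    (Nat.mod_lt _ (by norm_num)) (Nat.mod_lt _ (by norm_num))
  have h' := Nat.mul_le_mul_left (12 * c) (xor_le_add (v / 8) (w / 8))
  rw [Nat.mul_add] at h'
  omega

theorem closed (c k : ℕ) (hc : 0 < c) : CutReach c k (cutClosed c k) := by
  have h0 : 0 < 12 * c := by omega
  obtain ⟨q, x, hx, rfl⟩ : ∃ q x, x < 12 * c ∧ k = 12 * c * q + x :=
    ⟨_, _, Nat.mod_lt k h0, (Nat.div_add_mod _ _).symm⟩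
  have h8 := cutPeriod_lt_eight c x
  have he : (12 * c * q + x) % 2 = x % 2 := by
    rw [show 12 * c * q = 2 * (6 * c * q) by ring]
    omega
  rw [CutReach, cutClosed_add_mul c q x hx, he,
    show (8 * q + cutPeriod c x) / 8 = q by omega,
    show (8 * q + cutPeriod c x) % 8 = cutPeriod c x by omega]
  refine Nat.add_le_add_left ?_ _
  rcases cutPeriod_spec c x hx with h | h | h | h | h | h | h | h | h | h | h | h | h <;>
  rcases Nat.mod_two_eq_zero_or_one x with e | e <;>
  simp only [h.1, e, cutThreshold] <;> omega

theorem list (c : ℕ) (hc : 0 < c) (l : List ℕ) (hl : ∀ x ∈ l, 0 < x) :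
    CutReach c (l.sum - l.length)
      ((l.map fun x => cutClosed c (x - 1)).foldr (· ^^^ ·) 0) ∧ l.length ≤ l.sum := by
  induction l with
  | nil => simp [CutReach, cutThreshold]
  | cons a l ih =>
    obtain ⟨h, hle⟩ := ih fun x hx => hl x (List.mem_cons_of_mem _ hx)
    have ha := hl a List.mem_cons_self
    have := xor hc (closed c (a - 1) hc) h
    simp only [List.map_cons, List.foldr_cons, List.sum_cons, List.length_cons]
    rw [show a + l.sum - (l.length + 1) = a - 1 + (l.sum - l.length) by omega]
    exact ⟨this, by omega⟩

theorem exists_pair {c m v : ℕ} (hc : 2 ≤ c) (h : CutReach c m v) :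
    ∃ i j k, i + j + 2 * k = m ∧ cutClosed c i ^^^ cutClosed c j = v := by
  obtain ⟨q, r, hr, rfl⟩ : ∃ q r, r < 8 ∧ v = 8 * q + r := ⟨v / 8, v % 8, by omega, by omega⟩
  have he : (12 * c * q) % 2 = 0 := by
    rw [show 12 * c * q = 2 * (6 * c * q) by ring]
    omega
  suffices H : ∃ x y, x < 12 * c ∧ y < 12 * c ∧ cutPeriod c x ^^^ cutPeriod c y = r ∧
      12 * c * q + x + y ≤ m ∧ (x + y) % 2 = m % 2 by
    obtain ⟨x, y, hx, hy, hxy, hle, hp⟩ := H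
    refine ⟨12 * c * q + x, y, (m - (12 * c * q + x + y)) / 2, by omega, ?_⟩
    have h8x := cutPeriod_lt_eight c x
    have h8y := cutPeriod_lt_eight c y
    rw [cutClosed_add_mul c q x hx, cutClosed_of_lt c y hy,
      ← Nat.div_add_mod ((8 * q + cutPeriod c x) ^^^ cutPeriod c y) 8, xor_div_eight,
      xor_mod_eight, show (8 * q + cutPeriod c x) / 8 = q by omega,
      show (8 * q + cutPeriod c x) % 8 = cutPeriod c x by omega, Nat.div_eq_of_lt h8y,
      Nat.mod_eq_of_lt h8y, hxy, Nat.xor_zero]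
  rw [CutReach, show (8 * q + r) / 8 = q by omega, show (8 * q + r) % 8 = r by omega] at h
  have single : ∀ x, x < 12 * c → cutPeriod c x = r → 12 * c * q + x ≤ m → x % 2 = m % 2 →
      ∃ x y, x < 12 * c ∧ y < 12 * c ∧ cutPeriod c x ^^^ cutPeriod c y = r ∧
      12 * c * q + x + y ≤ m ∧ (x + y) % 2 = m % 2 := fun x hx hr hle hp =>
    ⟨x, 0, hx, by omega, by simp [hr, cutPeriod_zero c (by omega)], by omega, by omega⟩
  have h0 : cutPeriod c 1 = 1 := by unfold cutPeriod; split_ifs <;> omega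
  have h2 : cutPeriod c (2 * c) = 2 := by unfold cutPeriod; split_ifs <;> omega
  have h4 : cutPeriod c (4 * c) = 1 := by unfold cutPeriod; split_ifs <;> omega
  have h41 : cutPeriod c (4 * c + 1) = 4 := by unfold cutPeriod; split_ifs <;> omega
  have h42 : cutPeriod c (4 * c + 2) = 5 := by unfold cutPeriod; split_ifs <;> omega
  rcases Nat.mod_two_eq_zero_or_one m with e | e <;> rw [e] at h <;> interval_cases r <;>
  simp only [cutThreshold] at h
  · exact single 0 (by omega) (by unfold cutPeriod; split_ifs <;> omega) (by omega) (by omega)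
  · exact single (4 * c) (by omega) h4 (by omega) (by omega)
  · exact single (2 * c) (by omega) h2 (by omega) (by omega)
  · exact single (6 * c) (by omega) (by unfold cutPeriod; split_ifs <;> omega) (by omega) (by omega)
  · exact single (8 * c) (by omega) (by unfold cutPeriod; split_ifs <;> omega) (by omega) (by omega)
  · exact single (4 * c + 2) (by omega) h42 (by omega) (by omega)
  · exact single (10 * c) (by omega) (by unfold cutPeriod; split_ifs <;> omega) (by omega)
      (by omega)
  · exact ⟨4 * c + 2, 2 * c, by omega, by omega, by rw [h42, h2]; rfl, by omega, by omega⟩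
  · exact ⟨4 * c, 1, by omega, by omega, by rw [h4, h0]; rfl, by omega, by omega⟩
  · exact single 1 (by omega) h0 (by omega) (by omega)
  · exact single (6 * c + 1) (by omega) (by unfold cutPeriod; split_ifs <;> omega) (by omega)
      (by omega)
  · exact single (2 * c + 1) (by omega) (by unfold cutPeriod; split_ifs <;> omega) (by omega)
      (by omega)
  · exact single (4 * c + 1) (by omega) h41 (by omega) (by omega)
  · exact single (8 * c + 1) (by omega) (by unfold cutPeriod; split_ifs <;> omega) (by omega)
      (by omega)
  · exact ⟨4 * c + 1, 2 * c, by omega, by omega, by rw [h41, h2]; rfl, by omega, by omega⟩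
  · exact single (10 * c + 1) (by omega) (by unfold cutPeriod; split_ifs <;> omega) (by omega)
      (by omega)

theorem exists_list {c m v p : ℕ} (hc : 2 ≤ c) (hp : 4 ≤ p) (h : CutReach c m v) :
    ∃ l : List ℕ, l.length = p ∧ (∀ x ∈ l, 0 < x) ∧ l.sum = m + p ∧
      (l.map fun x => cutClosed c (x - 1)).foldr (· ^^^ ·) 0 = v := by
  obtain ⟨i, j, k, hs, hv⟩ := h.exists_pair hc
  have h0 : cutClosed c 0 = 0 := by
    rw [cutClosed_of_lt c 0 (by omega), cutPeriod_zero c (by omega)]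
  have hz : ∀ n, ((List.replicate n 1).map fun x => cutClosed c (x - 1)).foldr (· ^^^ ·) 0 = 0 := by
    intro n
    induction n with
    | zero => rfl
    | succ n ih => simp [List.replicate_succ, h0] at ih ⊢; exact ih
  refine ⟨(i + 1) :: (j + 1) :: (k + 1) :: (k + 1) :: List.replicate (p - 4) 1, ?_, ?_, ?_, ?_⟩
  · simp; omega
  · intro x hx
    simp only [List.mem_cons, List.mem_replicate] at hx
    omega
  · simp; omega
  · simp only [List.map_cons, List.foldr_cons, hz, Nat.add_sub_cancel]
    simp [hv]

end CutReach

theorem cutReach_or_pair_of_lt (c k v : ℕ) (hc : 2 ≤ c) (hv : v < cutClosed c k) :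
    (2 * c ≤ k ∧ CutReach c (k - 2 * c) v) ∨
      ∃ i j, i + j + 1 = k ∧ cutClosed c i ^^^ cutClosed c j = v := by
  have h0 : 0 < 12 * c := by omega
  obtain ⟨q, x, hx, rfl⟩ : ∃ q x, x < 12 * c ∧ k = 12 * c * q + x :=
    ⟨_, _, Nat.mod_lt k h0, (Nat.div_add_mod _ _).symm⟩
  obtain ⟨s, r, hr, rfl⟩ : ∃ q r, r < 8 ∧ v = 8 * q + r := ⟨v / 8, v % 8, by omega, by omega⟩
  have he : (12 * c * q) % 2 = 0 := by
    rw [show 12 * c * q = 2 * (6 * c * q) by ring]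
    omega
  rw [cutClosed_add_mul c q x hx] at hv
  have h8 := cutPeriod_lt_eight c x
  rcases lt_or_eq_of_le (show s ≤ q by omega) with hsq | rfl
  · left
    have hmul : 12 * c * s + 12 * c ≤ 12 * c * q := by
      have := Nat.mul_le_mul_left (12 * c) (show s + 1 ≤ q from hsq)
      rwa [Nat.mul_add, Nat.mul_one] at this
    refine ⟨by omega, ?_⟩
    rw [CutReach, show (8 * s + r) / 8 = s by omega, show (8 * s + r) % 8 = r by omega,
      show (12 * c * q + x - 2 * c) % 2 = x % 2 by omega]
    rcases Nat.mod_two_eq_zero_or_one x with e | e <;> rw [e] <;> interval_cases r <;>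
    simp only [cutThreshold] <;> omega
  · have reach : 2 * c ≤ x → cutThreshold c r (x % 2) ≤ x - 2 * c →
        (2 * c ≤ 12 * c * s + x ∧ CutReach c (12 * c * s + x - 2 * c) (8 * s + r)) ∨
        ∃ i j, i + j + 1 = 12 * c * s + x ∧ cutClosed c i ^^^ cutClosed c j = 8 * s + r := by
      refine fun h1 h2 => Or.inl ⟨by omega, ?_⟩
      rw [CutReach, show (8 * s + r) / 8 = s by omega, show (8 * s + r) % 8 = r by omega,
        show (12 * c * s + x - 2 * c) % 2 = x % 2 by omega]
      omega
    have pair : ∀ a b, a + b + 1 = x → cutPeriod c a ^^^ cutPeriod c b = r →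
        (2 * c ≤ 12 * c * s + x ∧ CutReach c (12 * c * s + x - 2 * c) (8 * s + r)) ∨
        ∃ i j, i + j + 1 = 12 * c * s + x ∧ cutClosed c i ^^^ cutClosed c j = 8 * s + r := by
      refine fun a b h1 h2 => Or.inr ⟨12 * c * s + a, b, by omega, ?_⟩
      have h8a := cutPeriod_lt_eight c a
      have h8b := cutPeriod_lt_eight c b
      rw [cutClosed_add_mul c s a (by omega), cutClosed_of_lt c b (by omega),
        ← Nat.div_add_mod ((8 * s + cutPeriod c a) ^^^ cutPeriod c b) 8, xor_div_eight,
        xor_mod_eight, show (8 * s + cutPeriod c a) / 8 = s by omega,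
        show (8 * s + cutPeriod c a) % 8 = cutPeriod c a by omega, Nat.div_eq_of_lt h8b,
        Nat.mod_eq_of_lt h8b, h2, Nat.xor_zero]
    have hrx : r < cutPeriod c x := by omega
    have val : ∀ a b u w, a + b + 1 = x → cutPeriod c a = u → cutPeriod c b = w →
        u ^^^ w = r → _ := fun a b u w h1 hu hw h2 => pair a b h1 (by rw [hu, hw, h2])
    have P0 : ∀ a, a < 2 * c → cutPeriod c a = a % 2 := fun a h => if_pos h
    have P2 : ∀ a, 2 * c ≤ a → a < 4 * c → cutPeriod c a = 2 + a % 2 := fun a h h' => by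
      rw [cutPeriod, if_neg (by omega), if_pos h']
    have P4 : ∀ a, 4 * c < a → a < 6 * c → cutPeriod c a = 5 - a % 2 := fun a h h' => by
      rw [cutPeriod, if_neg (by omega), if_neg (by omega), if_neg (by omega), if_pos h']
    rcases cutPeriod_spec c x hx with h | h | h | h | h | h | h | h | h | h | h | h | h <;>
    rw [h.1] at hrx <;> interval_cases r <;>
    try
      refine reach (by omega) ?_
      rcases Nat.mod_two_eq_zero_or_one x with e | e <;> rw [e] <;>
      simp only [cutThreshold] <;> omega
    · exact val (x - 1) 0 0 0 (by omega) (by rw [P0 _ (by omega)]; omega) (P0 0 (by omega)) rfl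
    · exact val (2 * c - 1) (x - 2 * c) 1 0 (by omega) (by rw [P0 _ (by omega)]; omega)
        (by rw [P0 _ (by omega)]; omega) rfl
    · exact val (2 * c - 1) (x - 2 * c) 1 1 (by omega) (by rw [P0 _ (by omega)]; omega)
        (by rw [P0 _ (by omega)]; omega) rfl
    · exact val (x - 1) 0 2 0 (by omega) (by rw [P2 _ (by omega) (by omega)]; omega)
        (P0 0 (by omega)) rfl
    · exact val (x - 1 - 2 * c) (2 * c) 3 2 (by omega)
        (by rw [P2 _ (by omega) (by omega)]; omega) (by rw [P2 _ (by omega) (by omega)]; omega) rfl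
    · exact val (4 * c - 1) (x - 4 * c) 3 0 (by omega)
        (by rw [P2 _ (by omega) (by omega)]; omega) (by rw [P0 _ (by omega)]; omega) rfl
    · exact val (x - 1) 0 4 0 (by omega) (by rw [P4 _ (by omega) (by omega)]; omega)
        (P0 0 (by omega)) rfl
    · exact val (x - 1 - 2 * c) (2 * c) 2 2 (by omega)
        (by rw [P2 _ (by omega) (by omega)]; omega) (by rw [P2 _ (by omega) (by omega)]; omega) rfl
    · exact val (4 * c - 1) (x - 4 * c) 3 1 (by omega)
        (by rw [P2 _ (by omega) (by omega)]; omega) (by rw [P0 _ (by omega)]; omega) rfl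

theorem mex_eq {S : Set ℕ} {g : ℕ} (hg : g ∉ S) (h : ∀ v < g, v ∈ S) : mex S = g := by
  refine le_antisymm (Nat.sInf_le hg) (le_csInf ⟨g, hg⟩ fun v hv => ?_)
  by_contra hlt
  exact hv (h v (not_le.mp hlt))

theorem not_cutReach_closed (c k : ℕ) (hk : 2 * c ≤ k) (hc : 0 < c) :
    ¬ CutReach c (k - 2 * c) (cutClosed c k) := by
  have h0 : 0 < 12 * c := by omega
  obtain ⟨q, x, hx, rfl⟩ : ∃ q x, x < 12 * c ∧ k = 12 * c * q + x :=
    ⟨_, _, Nat.mod_lt k h0, (Nat.div_add_mod _ _).symm⟩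
  have h8 := cutPeriod_lt_eight c x
  have he : (12 * c * q) % 2 = 0 := by
    rw [show 12 * c * q = 2 * (6 * c * q) by ring]
    omega
  rw [CutReach, cutClosed_add_mul c q x hx,
    show (8 * q + cutPeriod c x) / 8 = q by omega,
    show (8 * q + cutPeriod c x) % 8 = cutPeriod c x by omega,
    show (12 * c * q + x - 2 * c) % 2 = x % 2 by omega]
  rcases cutPeriod_spec c x hx with h | h | h | h | h | h | h | h | h | h | h | h | h <;>
  rcases Nat.mod_two_eq_zero_or_one x with e | e <;>
  simp only [h.1, e, cutThreshold] <;> omega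

theorem cutGAux_eq (c : ℕ) (hc : 2 ≤ c) (fuel n : ℕ) (hn : 0 < n) (hle : n ≤ fuel) :
    cutGAux {1, 2 * c} fuel n = cutClosed c (n - 1) := by
  induction fuel generalizing n with
  | zero => omega
  | succ fuel ih =>
    have hmap : ∀ l : List ℕ, 2 ≤ l.length → (∀ x ∈ l, 0 < x) → l.sum = n →
        l.map (cutGAux {1, 2 * c} fuel) = l.map fun x => cutClosed c (x - 1) := by
      intro l hlen hpos hsum
      refine List.map_congr_left fun x hx => ih x (hpos x hx) ?_
      have h1 := (CutReach.list c (by omega) (l.erase x)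
        fun y hy => hpos y (List.mem_of_mem_erase hy)).2
      have h2 := List.sum_erase hx
      have h3 := List.length_erase_of_mem hx
      omega
    rw [cutGAux]
    apply mex_eq
    · rintro ⟨d, hd, l, hlen, hpos, hsum, hv⟩
      simp only [Finset.mem_insert, Finset.mem_singleton] at hd
      rw [hmap l (by omega) hpos hsum] at hv
      rcases hd with rfl | rfl
      · obtain ⟨a, b, rfl⟩ := List.length_eq_two.mp hlen
        have ha := hpos a (by simp)
        have hb := hpos b (by simp)
        simp only [List.map_cons, List.map_nil, List.foldr_cons, List.foldr_nil,
          Nat.xor_zero] at hv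
        simp only [List.sum_cons, List.sum_nil] at hsum
        refine cutClosed_xor_ne c (a - 1) (b - 1) (by omega) (hv.trans ?_)
        congr 1
        omega
      · obtain ⟨h, hle'⟩ := CutReach.list c (by omega) l hpos
        rw [hv, hsum, hlen] at h
        refine not_cutReach_closed c (n - 1) (by omega) (by omega) ?_
        rwa [show n - 1 - 2 * c = n - (2 * c + 1) by omega]
    · intro v hv
      rcases cutReach_or_pair_of_lt c (n - 1) v hc hv with ⟨hk, h⟩ | ⟨i, j, hij, h⟩
      · obtain ⟨l, hlen, hpos, hsum, hx⟩ := h.exists_list hc (p := 2 * c + 1) (by omega)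
        refine ⟨2 * c, by simp, l, hlen, hpos, by omega, ?_⟩
        rw [hmap l (by omega) hpos (by omega), hx]
      · refine ⟨1, by simp, [i + 1, j + 1], rfl, by simp, by simp; omega, ?_⟩
        rw [hmap _ (by simp) (by simp) (by simp; omega)]
        simpa using h

theorem nimSet_eq_setOf_cutReach (c : ℕ) (hc : 2 ≤ c) (p n : ℕ) (hp : 4 ≤ p) (hn : p ≤ n) :
    nimSet n p {1, 2 * c} = {v | CutReach c (n - p) v} := by
  have hval : ∀ l : List ℕ, (∀ x ∈ l, 0 < x) → nimVal {1, 2 * c} l =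
      (l.map fun x => cutClosed c (x - 1)).foldr (· ^^^ ·) 0 := by
    intro l hl
    have h : l.map (cutG {1, 2 * c}) = l.map fun x => cutClosed c (x - 1) :=
      List.map_congr_left fun x hx => cutGAux_eq c hc x x (hl x hx) le_rfl
    rw [nimVal, h]
  ext v
  constructor
  · rintro ⟨l, rfl, hpos, rfl, rfl⟩
    rw [hval l hpos]
    exact (CutReach.list c (by omega) l hpos).1
  · intro h
    obtain ⟨l, hlen, hpos, hsum, hx⟩ := CutReach.exists_list hc hp h
    exact ⟨l, hlen, hpos, by omega, (hval l hpos).trans hx⟩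

/-- The nim-set recursion: for `p ≥ 4` and `c ≥ 2`,
`N(n+1, p+1, {1,2c}) = N(n, p, {1,2c})`. -/
theorem nimSet_recursion (p : ℕ) (hp : 4 ≤ p) (c : ℕ) (hc : 2 ≤ c)
    (n : ℕ) (hn : p ≤ n) :
    nimSet (n + 1) (p + 1) {1, 2*c} = nimSet n p {1, 2*c} := by
  rw [nimSet_eq_setOf_cutReach c hc _ _ (by omega) (by omega),
    nimSet_eq_setOf_cutReach c hc _ _ hp hn, Nat.add_sub_add_right]
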